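/- arXiv:1408.5027 — 3 statements merged into one kernel-verified Lean document; each statement's English description precedes it below -/
import Mathlib

section
/- Let d be an even positive integer. Then the sequence e_d(n)/n converges to 2/d as n → ∞; in particular h(d) := limsup_{n→∞} e_d(n)/n = 2/d. -/
open Filter

/-- A finite subset `S` of the `n`-dimensional hypercube (binary sequences of
length `n`) is `d`-equilateral if it is nonempty and any two distinct points
have Hamming distance exactly `d`. -/
def IsEquilateralSet {n : ℕ} (d : ℕ) (S : Finset (Fin n → Bool)) : Prop :=
  S.Nonempty ∧ ∀ x ∈ S, ∀ y ∈ S, x ≠ y → hammingDist x y = d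

/-- `equilateralDim d n` is the maximal size of a `d`-equilateral subset of the
`n`-dimensional hypercube. -/
noncomputable def equilateralDim (d n : ℕ) : ℕ :=
  sSup {m : ℕ | ∃ S : Finset (Fin n → Bool), IsEquilateralSet d S ∧ S.card = m}

open Finset in
/-- A large family of `2k`-element sets any two of which meet in exactly `k` points has
a common `k`-element subset. -/
theorem exists_common_kernel {α : Type*} [DecidableEq α] (k : ℕ) (F : Finset (Finset α))
    (hcard : ∀ A ∈ F, #A = 2 * k)
    (hinter : ∀ A ∈ F, ∀ B ∈ F, A ≠ B → #(A ∩ B) = k)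
    (hF : 2 ^ (2 * k) * (2 * k) + 1 < #F) :
    ∃ K : Finset α, #K = k ∧ ∀ A ∈ F, K ⊆ A := by
  obtain ⟨A, hA⟩ : F.Nonempty := card_pos.1 (by omega)
  have hlt : #A.powerset * (2 * k) < #(F.erase A) := by
    rw [card_powerset, hcard A hA, card_erase_of_mem hA]
    omega
  obtain ⟨K, -, hK⟩ := exists_lt_card_fiber_of_mul_lt_card_of_maps_to
    (f := fun B => A ∩ B) (fun B _ => mem_powerset.2 inter_subset_left) hlt
  set G := {B ∈ F.erase A | A ∩ B = K} with hG
  have hGF : ∀ B ∈ G, B ∈ F ∧ B ≠ A ∧ A ∩ B = K := by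
    intro B hB
    simp only [hG, mem_filter, mem_erase] at hB
    exact ⟨hB.1.2, hB.1.1, hB.2⟩
  have hKG : ∀ B ∈ G, K ⊆ B := fun B hB => (hGF B hB).2.2 ▸ inter_subset_right
  obtain ⟨B₀, hB₀⟩ : G.Nonempty := card_pos.1 (by omega)
  have hKcard : #K = k := by
    obtain ⟨h1, h2, h3⟩ := hGF B₀ hB₀
    rw [← h3]
    exact hinter A hA B₀ h1 h2.symm
  refine ⟨K, hKcard, fun B hB => ?_⟩
  by_contra hKB
  have hBG : B ∉ G := fun h => hKB (hKG B h)
  have hpetal : ∀ C ∈ G, (B ∩ (C \ K)).Nonempty := by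
    intro C hC
    by_contra hempty
    rw [not_nonempty_iff_eq_empty] at hempty
    have hsub : B ∩ C ⊆ K := by
      intro x hx
      by_contra hxK
      have : x ∈ B ∩ (C \ K) := by
        rw [mem_inter] at hx
        exact mem_inter.2 ⟨hx.1, Finset.mem_sdiff.2 ⟨hx.2, hxK⟩⟩
      simp [hempty] at this
    have hBC := hinter B hB C (hGF C hC).1 (fun h => hBG (h ▸ hC))
    have heq := eq_of_subset_of_card_le hsub (by omega)
    exact hKB (heq ▸ inter_subset_left)
  have hdisj : (G : Set (Finset α)).PairwiseDisjoint (fun C => B ∩ (C \ K)) := by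
    intro C hC D hD hCD
    have hCDK : K = C ∩ D := eq_of_subset_of_card_le
      (subset_inter (hKG C hC) (hKG D hD))
      (by rw [hinter C (hGF C hC).1 D (hGF D hD).1 hCD, hKcard])
    rw [Function.onFun, disjoint_left]
    intro x hx hy
    simp only [mem_inter, Finset.mem_sdiff] at hx hy
    exact hx.2.2 (hCDK ▸ mem_inter.2 ⟨hx.2.1, hy.2.1⟩)
  have h1 : #G ≤ #(G.biUnion fun C => B ∩ (C \ K)) := card_le_card_biUnion hdisj hpetal
  have h2 : #(G.biUnion fun C => B ∩ (C \ K)) ≤ #B :=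
    card_le_card (biUnion_subset.2 fun C _ => inter_subset_left)
  have h3 := hcard B hB
  omega

open Finset in
/-- A large family of `2k`-element sets any two of which meet in exactly `k` points is
a sunflower, so its size is bounded linearly by the size of the ground set. -/
theorem card_add_one_mul_le_of_inter_card {α : Type*} [Fintype α] [DecidableEq α] (k : ℕ)
    (F : Finset (Finset α)) (hcard : ∀ A ∈ F, #A = 2 * k)
    (hinter : ∀ A ∈ F, ∀ B ∈ F, A ≠ B → #(A ∩ B) = k)
    (hF : 2 ^ (2 * k) * (2 * k) + 1 < #F) :
    (#F + 1) * k ≤ Fintype.card α := by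
  obtain ⟨K, hK, hKF⟩ := exists_common_kernel k F hcard hinter hF
  have hdisj : (F : Set (Finset α)).PairwiseDisjoint (fun C => C \ K) := by
    intro C hC D hD hCD
    have hCDK : K = C ∩ D := eq_of_subset_of_card_le
      (subset_inter (hKF C hC) (hKF D hD)) (by rw [hinter C hC D hD hCD, hK])
    rw [Function.onFun, disjoint_left]
    intro x hx hy
    simp only [Finset.mem_sdiff] at hx hy
    exact hx.2 (hCDK ▸ mem_inter.2 ⟨hx.1, hy.1⟩)
  have hunion : #(F.biUnion fun C => C \ K) = #F * k := by
    rw [card_biUnion hdisj, sum_const_nat]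
    intro C hC
    rw [card_sdiff_of_subset (hKF C hC), hcard C hC, hK]
    omega
  have hKdisj : Disjoint (F.biUnion fun C => C \ K) K := by
    rw [disjoint_biUnion_left]
    exact fun C _ => sdiff_disjoint
  have := card_le_univ ((F.biUnion fun C => C \ K) ∪ K)
  rw [card_union_of_disjoint hKdisj, hunion, hK] at this
  linarith

open Finset in
theorem IsEquilateralSet.card_mul_le {n k : ℕ} {S : Finset (Fin n → Bool)}
    (hS : IsEquilateralSet (2 * k) S) (hcard : 2 ^ (2 * k) * (2 * k) + 2 < #S) :
    #S * k ≤ n := by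
  obtain ⟨⟨a, ha⟩, hdist⟩ := hS
  let supp : (Fin n → Bool) → Finset (Fin n) := fun x => {i | x i ≠ a i}
  have hinj : Function.Injective supp := by
    intro x y hxy
    funext i
    have := congrArg (i ∈ ·) hxy
    simp only [supp, mem_filter, mem_univ, true_and, eq_iff_iff] at this
    revert this
    cases x i <;> cases y i <;> cases a i <;> simp
  have hFcard : #((S.erase a).image supp) + 1 = #S := by
    rw [card_image_of_injective _ hinj, card_erase_add_one ha]
  have hsupp : ∀ x ∈ S.erase a, #(supp x) = 2 * k := fun x hx =>
    hdist x (mem_of_mem_erase hx) a ha (ne_of_mem_erase hx)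
  have key := card_add_one_mul_le_of_inter_card k ((S.erase a).image supp) ?_ ?_ (by omega)
  · rwa [hFcard, Fintype.card_fin] at key
  · simpa only [forall_mem_image] using hsupp
  · simp only [forall_mem_image]
    intro x hx y hy hxy
    have hxy' : #((supp x \ supp y) ∪ (supp y \ supp x)) = 2 * k := by
      rw [← hdist x (mem_of_mem_erase hx) y (mem_of_mem_erase hy) (fun h => hxy (h ▸ rfl))]
      unfold hammingDist
      congr 1
      ext i
      simp only [supp, mem_union, Finset.mem_sdiff, mem_filter, mem_univ, true_and]
      cases x i <;> cases y i <;> cases a i <;> simp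
    rw [card_union_of_disjoint disjoint_sdiff_sdiff] at hxy'
    have h1 := card_sdiff_add_card_inter (supp x) (supp y)
    have h2 := card_sdiff_add_card_inter (supp y) (supp x)
    rw [inter_comm (supp y)] at h2
    have h3 := hsupp x hx
    have h4 := hsupp y hy
    omega

open Finset in
theorem card_filter_val_div_eq {n k j : ℕ} (hk : 0 < k) (hj : j < n / k) :
    #{i : Fin n | (i : ℕ) / k = j} = k := by
  have hle : (j + 1) * k ≤ n := (Nat.le_div_iff_mul_le hk).1 hj
  have hmap : ({i : Fin n | (i : ℕ) / k = j} : Finset (Fin n)).map Fin.valEmbedding =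
      Ico (j * k) ((j + 1) * k) := by
    ext m
    simp only [Finset.mem_map, mem_filter, mem_univ, true_and, Fin.valEmbedding_apply, mem_Ico]
    constructor
    · rintro ⟨i, rfl, rfl⟩
      exact ⟨Nat.div_mul_le_self _ _, (Nat.div_lt_iff_lt_mul hk).1 (Nat.lt_add_one _)⟩
    · rintro ⟨h1, h2⟩
      refine ⟨⟨m, h2.trans_le hle⟩, ?_, rfl⟩
      exact le_antisymm (Nat.lt_add_one_iff.1 ((Nat.div_lt_iff_lt_mul hk).2 h2))
        ((Nat.le_div_iff_mul_le hk).2 h1)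
  rw [← card_map Fin.valEmbedding, hmap, Nat.card_Ico, add_one_mul, Nat.add_sub_cancel_left]

open Finset in
theorem exists_isEquilateralSet_card_eq_div {n k : ℕ} (hk : 0 < k) (hn : k ≤ n) :
    ∃ S : Finset (Fin n → Bool), IsEquilateralSet (2 * k) S ∧ #S = n / k := by
  let block : ℕ → Fin n → Bool := fun j i => decide ((i : ℕ) / k = j)
  have hdist : ∀ j < n / k, ∀ l < n / k, j ≠ l →
      hammingDist (block j) (block l) = 2 * k := by
    intro j hj l hl hjl
    have hdisj : Disjoint ({i : Fin n | (i : ℕ) / k = j} : Finset (Fin n))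
        ({i : Fin n | (i : ℕ) / k = l} : Finset (Fin n)) :=
      disjoint_filter.2 fun i _ h1 h2 => hjl (h1.symm.trans h2)
    have h := card_union_of_disjoint hdisj
    rw [card_filter_val_div_eq hk hj, card_filter_val_div_eq hk hl] at h
    rw [two_mul, ← h]
    unfold hammingDist
    congr 1
    ext i
    simp only [block, mem_union, mem_filter, mem_univ, true_and, ne_eq, decide_eq_decide]
    grind
  refine ⟨(range (n / k)).image block, ⟨?_, ?_⟩, ?_⟩
  · simpa using ⟨hk.ne', hn⟩
  · simp only [forall_mem_image, mem_range]
    exact fun j hj l hl hjl => hdist j hj l hl fun h => hjl (h ▸ rfl)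
  · rw [card_image_of_injOn, card_range]
    intro j hj l hl hjl
    by_contra hne
    have := hdist j (by simpa using hj) l (by simpa using hl) hne
    rw [hjl, hammingDist_self] at this
    omega

/-- For `n` large compared with `k`, the `2k`-equilateral dimension of the `n`-cube is
exactly `⌊n / k⌋`. -/
theorem equilateralDim_two_mul_eq_div {n k : ℕ} (hk : 0 < k)
    (hn : (2 ^ (2 * k) * (2 * k) + 2) * k ≤ n) : equilateralDim (2 * k) n = n / k := by
  obtain ⟨S, hS, hScard⟩ := exists_isEquilateralSet_card_eq_div hk
    (show k ≤ n from le_trans (Nat.le_mul_of_pos_left k (by omega)) hn)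
  refine IsGreatest.csSup_eq ⟨⟨S, hS, hScard⟩, ?_⟩
  rintro m ⟨T, hT, rfl⟩
  rw [Nat.le_div_iff_mul_le hk]
  by_cases h : 2 ^ (2 * k) * (2 * k) + 2 < T.card
  · exact hT.card_mul_le h
  · exact (Nat.mul_le_mul_right k (not_lt.1 h)).trans hn

theorem equilateralDim_even_ratio_tendsto (d : ℕ) (hd : 0 < d) (heven : Even d) :
    Tendsto (fun n : ℕ => (equilateralDim d n : ℝ) / n) atTop (nhds (2 / d)) ∧
    limsup (fun n : ℕ => (equilateralDim d n : ℝ) / n) atTop = 2 / d := by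
  suffices h : Tendsto (fun n : ℕ => (equilateralDim d n : ℝ) / n) atTop (nhds (2 / d)) from
    ⟨h, h.limsup_eq⟩
  obtain ⟨k, rfl⟩ := even_iff_exists_two_mul.1 heven
  have hk : 0 < k := by omega
  have hlim : Tendsto (fun n : ℕ => (⌊(k : ℝ)⁻¹ * n⌋₊ : ℝ) / n) atTop (nhds (k : ℝ)⁻¹) :=
    (tendsto_nat_floor_mul_div_atTop (by positivity)).comp tendsto_natCast_atTop_atTop
  have hval : (2 / (2 * k : ℕ) : ℝ) = (k : ℝ)⁻¹ := by
    push_cast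
    field_simp
  rw [hval]
  refine hlim.congr' ?_
  filter_upwards [eventually_ge_atTop ((2 ^ (2 * k) * (2 * k) + 2) * k)] with n hn
  rw [equilateralDim_two_mul_eq_div hk hn, inv_mul_eq_div, Nat.floor_div_eq_div]
end

section
/- Let q be a prime power and let k ≥ 0 be an integer. Set n(q,k) = q·(q^{2^{k+1}} − 1)/(q − 1), d(q,k) = 2·q^{2^{k+1} − 1}, and s(q,k) = q^{2^{k+1}}. Then e_{d(q,k)}(n(q,k)) ≥ s(q,k). -/
open Filter

open scoped LinearAlgebra.Projectivization

theorem card_le_equilateralDim {α ι : Type*} [Fintype α] [Nonempty α] [Fintype ι] {d : ℕ}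
    (hd : d ≠ 0) (f : α → ι → Bool) (hf : ∀ a b, a ≠ b → hammingDist (f a) (f b) = d) :
    Fintype.card α ≤ equilateralDim d (Fintype.card ι) := by
  classical
  let e := Fintype.equivFin ι
  let g : α → Fin (Fintype.card ι) → Bool := fun a i => f a (e.symm i)
  have hg : ∀ a b, a ≠ b → hammingDist (g a) (g b) = d := by
    intro a b hab
    rw [← hf a b hab]
    exact Finset.card_bij (fun i _ => e.symm i) (by simp [g]) (by simp)
      fun i hi => ⟨e i, by simpa [g] using hi, by simp⟩
  have g_injective : Function.Injective g := by
    intro a b hab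
    by_contra hne
    have := hg a b hne
    rw [hab, hammingDist_self] at this
    exact hd this.symm
  refine le_csSup ⟨Fintype.card (Fin (Fintype.card ι) → Bool), ?_⟩
    ⟨Finset.univ.image g, ⟨Finset.univ_nonempty.image g, ?_⟩, ?_⟩
  · rintro _ ⟨S, -, rfl⟩
    exact S.card_le_univ
  · simp only [Finset.mem_image, Finset.mem_univ, true_and]
    rintro _ ⟨a, rfl⟩ _ ⟨b, rfl⟩ hab
    exact hg a b fun h => hab (congrArg g h)
  · rw [Finset.card_image_of_injective _ g_injective, Finset.card_univ]

section Simplex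

variable {K : Type*} [Field K] [Fintype K] [DecidableEq K]

theorem card_dotProduct_eq_one {m : ℕ} {u : Fin (m + 1) → K} (hu : u ≠ 0) :
    Fintype.card {w : Fin (m + 1) → K // w ⬝ᵥ u = 1} = Fintype.card K ^ m := by
  obtain ⟨i, hi⟩ := Function.ne_iff.mp hu
  let φ : (Fin (m + 1) → K) →+ K :=
    { toFun := fun w => w ⬝ᵥ u
      map_zero' := zero_dotProduct u
      map_add' := fun w w' => add_dotProduct w w' u }
  have hφ : Function.Surjective φ := fun a =>
    ⟨Pi.single i (a / u i), by simpa [φ] using div_mul_cancel₀ a hi⟩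
  have hsum := Finset.card_eq_sum_card_fiberwise (f := φ) (s := Finset.univ) (t := Finset.univ)
    (fun _ _ => Finset.mem_coe.mpr (Finset.mem_univ _))
  rw [Finset.sum_congr rfl fun a _ =>
    AddMonoidHom.card_fiber_eq_of_mem_range φ (hφ a) (hφ 1)] at hsum
  simp only [Finset.card_univ, Fintype.card_fun, Fintype.card_fin, Finset.sum_const,
    smul_eq_mul, pow_succ'] at hsum
  rw [Fintype.card_subtype]
  exact (Nat.eq_of_mul_eq_mul_left Fintype.card_pos hsum).symm

/-- The projective points off the hyperplane orthogonal to `u` correspond to the vectors whose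
dot product with `u` is one. -/
noncomputable def affineChartEquiv {m : ℕ} (u : Fin m → K) :
    {P : ℙ K (Fin m → K) // P.rep ⬝ᵥ u ≠ 0} ≃ {w : Fin m → K // w ⬝ᵥ u = 1} where
  toFun P := ⟨(P.1.rep ⬝ᵥ u)⁻¹ • P.1.rep, by
    rw [smul_dotProduct, smul_eq_mul, inv_mul_cancel₀ P.2]⟩
  invFun w := ⟨Projectivization.mk K w.1 (by rintro h; simpa [h] using w.2), by
    obtain ⟨a, ha⟩ := Projectivization.exists_smul_eq_mk_rep K w.1
      (by rintro h; simpa [h] using w.2)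
    rw [← ha, Units.smul_def, smul_dotProduct, w.2]
    simp⟩
  left_inv P := by
    ext1
    conv_rhs => rw [← P.1.mk_rep]
    exact (Projectivization.mk_eq_mk_iff' K _ _ _ _).mpr ⟨_, rfl⟩
  right_inv w := by
    ext1
    obtain ⟨a, ha⟩ := Projectivization.exists_smul_eq_mk_rep K w.1
      (by rintro h; simpa [h] using w.2)
    simp only [← ha, Units.smul_def, smul_dotProduct, w.2, smul_smul]
    simp

/-- The one-hot encoding of the simplex code: the word of `v` records, for each projective
point, the value of the corresponding linear form at `v`. -/
noncomputable def simplexWord {m : ℕ} (v : Fin m → K) : ℙ K (Fin m → K) × K → Bool :=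
  fun x => decide (x.1.rep ⬝ᵥ v = x.2)

theorem card_filter_decide_eq_ne {α : Type*} [Fintype α] [DecidableEq α] (a b : α) :
    Finset.card {c : α | decide (a = c) ≠ decide (b = c)} = if a = b then 0 else 2 := by
  split_ifs with h
  · simp [h]
  · rw [← Finset.card_pair h]
    congr 1
    ext c
    simp only [Finset.mem_filter, Finset.mem_univ, true_and, Finset.mem_insert,
      Finset.mem_singleton, ne_eq, decide_eq_decide]
    grind

theorem hammingDist_simplexWord {m : ℕ} [Fintype (ℙ K (Fin (m + 1) → K))]
    {v w : Fin (m + 1) → K} (hvw : v ≠ w) :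
    hammingDist (simplexWord v) (simplexWord w) = 2 * Fintype.card K ^ m := by
  have hcard : Fintype.card {P : ℙ K (Fin (m + 1) → K) // P.rep ⬝ᵥ (v - w) ≠ 0} =
      Fintype.card K ^ m := by
    rw [Fintype.card_congr (affineChartEquiv (v - w)),
      card_dotProduct_eq_one (sub_ne_zero.mpr hvw)]
  rw [hammingDist, Finset.card_filter, Fintype.sum_prod_type]
  rw [← hcard, Fintype.card_subtype, Finset.card_filter, Finset.mul_sum]
  refine Finset.sum_congr rfl fun P _ => ?_
  rw [← Finset.card_filter]
  refine (card_filter_decide_eq_ne (P.rep ⬝ᵥ v) (P.rep ⬝ᵥ w)).trans ?_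
  simp only [dotProduct_sub, ne_eq, sub_eq_zero, ite_not, mul_ite, mul_zero, mul_one]

theorem card_pow_le_equilateralDim (K : Type*) [Field K] [Fintype K] (m : ℕ) :
    Fintype.card K ^ (m + 1) ≤ equilateralDim (2 * Fintype.card K ^ m)
      (Fintype.card K * ((Fintype.card K ^ (m + 1) - 1) / (Fintype.card K - 1))) := by
  classical
  have : Fintype (ℙ K (Fin (m + 1) → K)) := Fintype.ofFinite _
  have h := card_le_equilateralDim (mul_ne_zero two_ne_zero (pow_ne_zero m Fintype.card_ne_zero))
    (simplexWord (K := K) (m := m + 1)) fun v w => hammingDist_simplexWord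
  have hP : Fintype.card (ℙ K (Fin (m + 1) → K)) =
      (Fintype.card K ^ (m + 1) - 1) / (Fintype.card K - 1) := by
    simpa [Nat.card_eq_fintype_card] using Projectivization.card'' K (Fin (m + 1) → K)
  rwa [Fintype.card_prod, hP, mul_comm _ (Fintype.card K), Fintype.card_fun,
    Fintype.card_fin] at h

end Simplex

theorem equilateralDim_prime_power_iterate (q k : ℕ) (hq : IsPrimePow q) :
    q ^ 2 ^ (k + 1) ≤
      equilateralDim (2 * q ^ (2 ^ (k + 1) - 1))
        (q * ((q ^ 2 ^ (k + 1) - 1) / (q - 1))) := by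
  obtain ⟨p, n, hp, hn, rfl⟩ := hq
  have : Fact p.Prime := ⟨hp.nat_prime⟩
  have : Fintype (GaloisField p n) := Fintype.ofFinite _
  have hK : Fintype.card (GaloisField p n) = p ^ n := by
    rw [← Nat.card_eq_fintype_card, GaloisField.card p n hn.ne']
  have h := card_pow_le_equilateralDim (GaloisField p n) (2 ^ (k + 1) - 1)
  rwa [hK, Nat.sub_add_cancel Nat.one_le_two_pow] at h
end

section
/- Let α be a real number with 0 < α ≤ 1/2 and define f(α) := limsup_{n→∞} log(e_{⌊n^α⌋}(n))/log(n). Then f(α) = max{1 − α, 2α}. -/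
open Filter

lemma equilateralDim_set_bddAbove (d n : ℕ) :
    BddAbove {m : ℕ | ∃ S : Finset (Fin n → Bool), IsEquilateralSet d S ∧ S.card = m} :=
  ⟨Fintype.card (Fin n → Bool), by rintro m ⟨S, -, rfl⟩; exact S.card_le_univ⟩

lemma IsEquilateralSet.card_le_equilateralDim {d n : ℕ} {S : Finset (Fin n → Bool)}
    (hS : IsEquilateralSet d S) : S.card ≤ equilateralDim d n :=
  le_csSup (equilateralDim_set_bddAbove d n) ⟨S, hS, rfl⟩

lemma isEquilateralSet_singleton {n : ℕ} (d : ℕ) (x : Fin n → Bool) :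
    IsEquilateralSet d {x} := by
  refine ⟨Finset.singleton_nonempty x, fun y hy z hz hyz => ?_⟩
  rw [Finset.mem_singleton] at hy hz
  exact absurd (hy.trans hz.symm) hyz

lemma exists_isEquilateralSet_card_eq (d n : ℕ) :
    ∃ S : Finset (Fin n → Bool), IsEquilateralSet d S ∧ S.card = equilateralDim d n :=
  Nat.sSup_mem
    (s := {m : ℕ | ∃ S : Finset (Fin n → Bool), IsEquilateralSet d S ∧ S.card = m})
    ⟨1, {fun _ => false}, isEquilateralSet_singleton d _, rfl⟩
    (equilateralDim_set_bddAbove d n)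

lemma equilateralDim_pos (d n : ℕ) : 0 < equilateralDim d n :=
  (isEquilateralSet_singleton (n := n) d fun _ => false).card_le_equilateralDim

/-- The squared-distance form is negative on weights summing to zero. -/
lemma sum_mul_hammingDist_le {n : ℕ} (S : Finset (Fin n → Bool)) (c : (Fin n → Bool) → ℤ)
    (hc : ∑ x ∈ S, c x = 0) (i : Fin n) :
    ∑ x ∈ S, ∑ y ∈ S, c x * c y * (hammingDist x y : ℤ) ≤
      -2 * (∑ x ∈ S, c x * (x i).toNat) ^ 2 := by
  have key : ∑ x ∈ S, ∑ y ∈ S, c x * c y * (hammingDist x y : ℤ) =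
      ∑ j, -2 * (∑ x ∈ S, c x * (x j).toNat) ^ 2 := by
    have hd : ∀ x y : Fin n → Bool, (hammingDist x y : ℤ) =
        ∑ j, (((x j).toNat : ℤ) + (y j).toNat - 2 * (x j).toNat * (y j).toNat) := by
      intro x y
      rw [hammingDist, Finset.card_filter]
      push_cast
      refine Finset.sum_congr rfl fun j _ => ?_
      cases x j <;> cases y j <;> simp
    simp_rw [hd, Finset.mul_sum]
    rw [Finset.sum_congr rfl fun x _ => Finset.sum_comm, Finset.sum_comm]
    refine Finset.sum_congr rfl fun j _ => ?_
    have expand : ∀ x y : Fin n → Bool, c x * c y *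
        (((x j).toNat : ℤ) + (y j).toNat - 2 * (x j).toNat * (y j).toNat) =
        (c x * (x j).toNat) * c y + c x * (c y * (y j).toNat) -
          2 * ((c x * (x j).toNat) * (c y * (y j).toNat)) := by
      intro x y; ring
    simp_rw [expand, Finset.sum_sub_distrib, Finset.sum_add_distrib, ← Finset.mul_sum,
      ← Finset.sum_mul, hc]
    ring
  rw [key, ← Finset.add_sum_erase _ _ (Finset.mem_univ i)]
  have : ∑ j ∈ Finset.univ.erase i, -2 * (∑ x ∈ S, c x * (x j).toNat) ^ 2 ≤ 0 :=
    Finset.sum_nonpos fun j _ => by nlinarith [sq_nonneg (∑ x ∈ S, c x * ((x j).toNat : ℤ))]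
  linarith

/-- A coordinate splits an equilateral set of size `a + b` into parts with `2ab ≤ d(a + b)`. -/
lemma IsEquilateralSet.two_mul_card_mul_card_le {d n : ℕ} {S : Finset (Fin n → Bool)}
    (hS : IsEquilateralSet d S) (i : Fin n) :
    2 * ((S.filter fun x => x i = true).card * (S.filter fun x => x i = false).card) ≤
      d * ((S.filter fun x => x i = true).card + (S.filter fun x => x i = false).card) := by
  set a := (S.filter fun x => x i = true).card with ha
  set b := (S.filter fun x => x i = false).card with hb
  have split : ∀ p q : ℤ, ∑ x ∈ S, (if x i = true then p else q) = a * p + b * q := by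
    intro p q
    rw [Finset.sum_ite]
    simp [ha, hb]
  set c : (Fin n → Bool) → ℤ := fun x => if x i = true then (b : ℤ) else -a with hc
  have hc0 : ∑ x ∈ S, c x = 0 := by rw [split]; ring
  have hle := sum_mul_hammingDist_le S c hc0 i
  have h1 : ∑ x ∈ S, c x * (x i).toNat = a * b := by
    have : ∀ x ∈ S, c x * (x i).toNat = if x i = true then (b : ℤ) else 0 := by
      intro x _; cases h : x i <;> simp [hc, h]
    rw [Finset.sum_congr rfl this, split]; ring
  have h2 : ∑ x ∈ S, c x ^ 2 = a * b ^ 2 + b * a ^ 2 := by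
    have : ∀ x ∈ S, c x ^ 2 = if x i = true then (b : ℤ) ^ 2 else a ^ 2 := by
      intro x _; cases h : x i <;> simp [hc, h]
    rw [Finset.sum_congr rfl this, split]
  have h3 : ∑ x ∈ S, ∑ y ∈ S, c x * c y * (hammingDist x y : ℤ) = -d * ∑ x ∈ S, c x ^ 2 := by
    have : ∀ x ∈ S, ∑ y ∈ S, c x * c y * (hammingDist x y : ℤ) = -d * c x ^ 2 := by
      intro x hx
      have h4 : ∀ y ∈ S, c x * c y * (hammingDist x y : ℤ) =
          c x * d * c y - if x = y then d * c x ^ 2 else 0 := by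
        intro y hy
        by_cases hxy : x = y
        · subst hxy; simp; ring
        · rw [hS.2 x hx y hy hxy]; simp [hxy]; ring
      rw [Finset.sum_congr rfl h4, Finset.sum_sub_distrib, ← Finset.mul_sum, hc0]
      simp [hx]
    rw [Finset.sum_congr rfl this, Finset.mul_sum]
  rw [h3, h2, h1] at hle
  rcases Nat.eq_zero_or_pos (a * b) with h0 | hpos
  · simp [h0]
  · have hpos' : (0 : ℤ) < a * b := by exact_mod_cast hpos
    zify
    refine le_of_mul_le_mul_left ?_ hpos'
    linarith

lemma IsEquilateralSet.exists_card_filter_ne_le {d n : ℕ} {S : Finset (Fin n → Bool)}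
    (hS : IsEquilateralSet d S) (i : Fin n) :
    ∃ b : Bool, (S.filter fun x => x i ≠ b).card ≤ d := by
  have h := hS.two_mul_card_mul_card_le i
  have ht : (S.filter fun x => x i ≠ true) = S.filter fun x => x i = false := by simp
  have hf : (S.filter fun x => x i ≠ false) = S.filter fun x => x i = true := by simp
  set a := (S.filter fun x => x i = true).card
  set b := (S.filter fun x => x i = false).card
  by_contra! hcon
  have ha := hcon false
  have hb := hcon true
  rw [hf] at ha
  rw [ht] at hb
  change d < a at ha
  change d < b at hb
  nlinarith

/-- An equilateral set has size at most quadratic in `d`, or is a sunflower up to translation. -/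
lemma IsEquilateralSet.card_le_or {d n : ℕ} (hd : 0 < d) {S : Finset (Fin n → Bool)}
    (hS : IsEquilateralSet d S) : S.card ≤ 4 * d ^ 2 ∨ S.card * d ≤ 2 * n := by
  rw [or_iff_not_imp_left, not_le]
  intro hm
  choose c hcd using hS.exists_card_filter_ne_le
  set m := S.card with hmdef
  set r : Fin n → ℕ := fun i => (S.filter fun x => x i ≠ c i).card with hr
  set T : (Fin n → Bool) → ℕ := fun x => ∑ i with x i ≠ c i, r i with hT
  have sum_r : ∑ x ∈ S, hammingDist x c = ∑ i, r i := by
    simp_rw [hr, hammingDist, Finset.card_filter]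
    exact Finset.sum_comm
  have sum_dist : ∀ x ∈ S, ∑ y ∈ S, hammingDist x y = d * (m - 1) := by
    intro x hx
    rw [← Finset.add_sum_erase _ _ hx, hammingDist_self, zero_add,
      Finset.sum_congr rfl fun y hy => hS.2 x hx y (Finset.mem_of_mem_erase hy)
        (Finset.ne_of_mem_erase hy).symm, Finset.sum_const, Finset.card_erase_of_mem hx,
      smul_eq_mul, mul_comm]
  have count : ∀ x ∈ S, m * hammingDist x c + ∑ i, r i = d * (m - 1) + 2 * T x := by
    intro x hx
    rw [← sum_dist x hx]
    simp_rw [hT, hammingDist, Finset.card_filter]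
    rw [Finset.sum_comm, Finset.sum_filter, Finset.mul_sum, Finset.mul_sum,
      ← Finset.sum_add_distrib, ← Finset.sum_add_distrib]
    refine Finset.sum_congr rfl fun i _ => ?_
    rw [← Finset.card_filter]
    have hsplit := Finset.card_filter_add_card_filter_not (s := S) (fun y => y i ≠ c i)
    have hri : r i = (S.filter fun y => y i ≠ c i).card := rfl
    by_cases hxi : x i = c i
    · simp only [hxi, ne_eq, not_true_eq_false, if_false, hri]
      simp [eq_comm]
    · have : (S.filter fun y => x i ≠ y i) = S.filter fun y => ¬ (y i ≠ c i) := by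
        refine Finset.filter_congr fun y _ => ?_
        revert hxi
        cases x i <;> cases y i <;> cases c i <;> simp
      rw [this]
      simp only [hxi, ne_eq, not_false_eq_true, if_true]
      simp only [ne_eq] at hsplit hri
      omega
  have T_le : ∀ x, T x ≤ hammingDist x c * d := by
    intro x
    exact Finset.sum_le_card_nsmul _ _ _ fun i _ => hcd i
  obtain ⟨m', hm'⟩ : ∃ m', m = m' + 1 := ⟨m - 1, by omega⟩
  rw [hm'] at hm count ⊢
  simp only [Nat.add_sub_cancel] at count
  have w_le : ∀ x ∈ S, hammingDist x c ≤ 2 * d := by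
    intro x hx
    have h1 := Nat.le.intro (count x hx)
    have h2 := T_le x
    by_contra! hlt
    have hdd : d ≤ d ^ 2 := Nat.le_self_pow two_ne_zero d
    obtain ⟨s, hs⟩ := Nat.exists_eq_add_of_le (show 2 * d ≤ m' + 1 by omega)
    have h3 : 2 * d ^ 2 ≤ s := by omega
    have h4 : s * hammingDist x c ≤ d * (2 * d + s) := by rw [← hs]; rw [hs] at h1; nlinarith
    have h5 : s * (2 * d + 1) ≤ s * hammingDist x c := Nat.mul_le_mul_left s hlt
    nlinarith
  have T_le' : ∀ x ∈ S, T x ≤ 2 * d ^ 2 := fun x hx => by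
    nlinarith [T_le x, w_le x hx]
  have w_eq : ∀ x ∈ S, ∀ y ∈ S, hammingDist x c ≤ hammingDist y c := by
    intro x hx y hy
    by_contra! hlt
    nlinarith [count x hx, count y hy, T_le' x hx, T_le' y hy]
  have sum_r_eq : ∀ x ∈ S, ∑ i, r i = (m' + 1) * hammingDist x c := by
    intro x hx
    rw [← sum_r, Finset.sum_congr rfl fun y hy => le_antisymm (w_eq y hy x hx) (w_eq x hx y hy),
      Finset.sum_const, smul_eq_mul, ← hmdef, hm']
  have two_w : ∀ x ∈ S, 2 * hammingDist x c = d := by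
    intro x hx
    have h1 := count x hx
    have h2 := T_le' x hx
    rw [sum_r_eq x hx] at h1
    refine le_antisymm ?_ ?_
    · by_contra! hlt
      nlinarith
    · by_contra! hlt
      nlinarith
  have T_eq : ∀ x ∈ S, hammingDist x c = T x := by
    intro x hx
    have h1 := count x hx
    rw [sum_r_eq x hx] at h1
    have h2 := two_w x hx
    nlinarith
  have r_le : ∀ i, r i ≤ 1 := by
    intro i
    by_contra! hlt
    obtain ⟨x, hx⟩ := Finset.card_pos.1 (zero_lt_one.trans hlt)
    obtain ⟨hxS, hxi⟩ := Finset.mem_filter.1 hx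
    have h := T_eq x hxS
    rw [hammingDist, Finset.card_eq_sum_ones] at h
    have h' := (Finset.sum_eq_sum_iff_of_le fun j hj => ?_).1 h i
      (Finset.mem_filter.2 ⟨Finset.mem_univ i, hxi⟩)
    · omega
    · exact Finset.card_pos.2 ⟨x, Finset.mem_filter.2 ⟨hxS, (Finset.mem_filter.1 hj).2⟩⟩
  obtain ⟨x, hx⟩ := hS.1
  have hR : ∑ i, r i ≤ n := by
    simpa using Finset.sum_le_card_nsmul Finset.univ r 1 fun i _ => r_le i
  rw [sum_r_eq x hx] at hR
  rw [← two_w x hx]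
  linarith

lemma equilateralDim_le_or {d : ℕ} (hd : 0 < d) (n : ℕ) :
    equilateralDim d n ≤ 4 * d ^ 2 ∨ equilateralDim d n * d ≤ 2 * n := by
  obtain ⟨S, hS, h⟩ := exists_isEquilateralSet_card_eq d n
  rw [← h]
  exact hS.card_le_or hd

lemma card_le_equilateralDim_s14 {ι P : Type*} [Fintype ι] [Nonempty ι] [Fintype P] [DecidableEq P]
    {d n : ℕ} (hd : 0 < d) (hP : Fintype.card P ≤ n) (A : ι → Finset P)
    (hA : ∀ i j, i ≠ j → (symmDiff (A i) (A j)).card = d) :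
    Fintype.card ι ≤ equilateralDim d n := by
  classical
  obtain ⟨e⟩ : Nonempty (P ↪ Fin n) :=
    Function.Embedding.nonempty_of_card_le (by simpa using hP)
  set X : ι → Fin n → Bool := fun i t => decide (t ∈ (A i).map e) with hX
  have dist : ∀ i j, i ≠ j → hammingDist (X i) (X j) = d := by
    intro i j hij
    rw [← hA i j hij, ← Finset.card_map e, hammingDist]
    congr 1
    ext t
    simp only [hX, Finset.mem_filter, Finset.mem_univ, true_and, Finset.mem_map,
      Finset.mem_symmDiff, ne_eq, decide_eq_decide]
    constructor
    · intro h
      by_cases h1 : ∃ a ∈ A i, e a = t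
      · obtain ⟨a, ha, rfl⟩ := h1
        refine ⟨a, Or.inl ⟨ha, fun h2 => h ?_⟩, rfl⟩
        exact ⟨fun _ => ⟨a, h2, rfl⟩, fun _ => ⟨a, ha, rfl⟩⟩
      · by_cases h2 : ∃ a ∈ A j, e a = t
        · obtain ⟨a, ha, rfl⟩ := h2
          exact ⟨a, Or.inr ⟨ha, fun h3 => h1 ⟨a, h3, rfl⟩⟩, rfl⟩
        · exact absurd (iff_of_false h1 h2) h
    · rintro ⟨a, ha, rfl⟩
      simp only [EmbeddingLike.apply_eq_iff_eq, exists_eq_right]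
      tauto
  have inj : Function.Injective X := by
    intro i j h
    by_contra hij
    have := dist i j hij
    rw [h, hammingDist_self] at this
    omega
  have hS : IsEquilateralSet d (Finset.univ.image X) := by
    refine ⟨Finset.univ_nonempty.image X, fun x hx y hy hxy => ?_⟩
    obtain ⟨i, -, rfl⟩ := Finset.mem_image.1 hx
    obtain ⟨j, -, rfl⟩ := Finset.mem_image.1 hy
    exact dist i j fun h => hxy (h ▸ rfl)
  have := hS.card_le_equilateralDim
  rwa [Finset.card_image_of_injective _ inj, Finset.card_univ] at this

lemma card_symmDiff_add {P : Type*} [DecidableEq P] (s t : Finset P) :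
    (symmDiff s t).card + 2 * (s ∩ t).card = s.card + t.card := by
  have h1 := Finset.card_sdiff_add_card_inter s t
  have h2 := Finset.card_sdiff_add_card_inter t s
  rw [symmDiff_def, Finset.sup_eq_union, Finset.card_union_of_disjoint disjoint_sdiff_sdiff]
  rw [Finset.inter_comm] at h2
  omega

lemma div_le_equilateralDim {q n : ℕ} (hq : 0 < q) (hn : q ≤ n) :
    n / q ≤ equilateralDim (2 * q) n := by
  have : Nonempty (Fin (n / q)) := ⟨⟨0, Nat.div_pos hn hq⟩⟩
  have h := card_le_equilateralDim_s14 (ι := Fin (n / q)) (P := Fin (n / q) × Fin q)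
    (d := 2 * q) (n := n) (by omega) (by simpa using Nat.div_mul_le_self n q)
    (fun j => {j} ×ˢ Finset.univ) (fun i j hij => ?_)
  · simpa using h
  · have h := card_symmDiff_add (({i} : Finset (Fin (n / q))) ×ˢ (Finset.univ : Finset (Fin q)))
      ({j} ×ˢ Finset.univ)
    rw [← Finset.inter_product, Finset.singleton_inter_of_notMem (by simpa using hij)] at h
    simp only [Finset.empty_product, Finset.card_empty, Finset.card_product,
      Finset.card_singleton, Finset.card_univ, Fintype.card_fin] at h
    omega

/-- The lines of an affine plane, each extended by the direction it has. -/
lemma sq_le_equilateralDim {q n : ℕ} (hq : q.Prime) (hn : (q + 1) * q ≤ n) :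
    q ^ 2 ≤ equilateralDim (2 * q) n := by
  have : Fact q.Prime := ⟨hq⟩
  let L : ZMod q × ZMod q → Option (ZMod q) → ZMod q := fun l o => o.elim l.1 fun x => l.1 * x + l.2
  let G : ZMod q × ZMod q → Finset (Option (ZMod q) × ZMod q) := fun l =>
    Finset.univ.map ⟨fun o => (o, L l o), fun o o' h => congrArg Prod.fst h⟩
  have hG : ∀ l, (G l).card = q + 1 := by simp [G, ZMod.card]
  have mem_G : ∀ l p, p ∈ G l ↔ L l p.1 = p.2 := by
    rintro l ⟨o, y⟩
    simp only [G, Finset.mem_map, Finset.mem_univ, true_and]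
    constructor
    · rintro ⟨a, h⟩
      obtain ⟨rfl, rfl⟩ := Prod.mk.inj h
      rfl
    · rintro rfl
      exact ⟨o, rfl⟩
  have h := card_le_equilateralDim_s14 (d := 2 * q) (n := n) (by have := hq.pos; omega)
    (by simpa [ZMod.card] using hn) G (fun l l' hl => ?_)
  · simpa [ZMod.card, sq] using h
  · have h1 : (G l ∩ G l').card = 1 := by
      obtain ⟨a, b⟩ := l
      obtain ⟨a', b'⟩ := l'
      rw [Finset.card_eq_one]
      by_cases ha : a = a'
      · subst ha
        refine ⟨(none, a), ?_⟩
        ext ⟨o, y⟩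
        rw [Finset.mem_inter, mem_G, mem_G, Finset.mem_singleton]
        cases o with
        | none => simp [L, eq_comm]
        | some x =>
          simp only [L, Option.elim, Prod.mk.injEq, reduceCtorEq, false_and, iff_false]
          rintro ⟨h1, h2⟩
          exact hl (Prod.ext rfl (add_left_cancel (h1.trans h2.symm)))
      · have hs : a - a' ≠ 0 := sub_ne_zero.2 ha
        refine ⟨(some ((b' - b) / (a - a')), a * ((b' - b) / (a - a')) + b), ?_⟩
        ext ⟨o, y⟩
        rw [Finset.mem_inter, mem_G, mem_G, Finset.mem_singleton]
        cases o with
        | none =>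
          simp only [L, Option.elim, Prod.mk.injEq, reduceCtorEq, false_and, iff_false]
          rintro ⟨h1, h2⟩
          exact ha (h1.trans h2.symm)
        | some x =>
          simp only [L, Option.elim, Prod.mk.injEq, Option.some.injEq]
          constructor
          · rintro ⟨h1, h2⟩
            have hx : x = (b' - b) / (a - a') := by
              rw [eq_div_iff hs]
              linear_combination h1 - h2
            exact ⟨hx, by rw [← hx, h1]⟩
          · rintro ⟨rfl, rfl⟩
            refine ⟨rfl, ?_⟩
            field_simp
            ring
    have h2 := card_symmDiff_add (G l) (G l')
    rw [h1, hG, hG] at h2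
    omega

lemma eventually_equilateralDim_le {α : ℝ} (h1 : 0 < α) :
    ∀ᶠ n : ℕ in atTop,
      (equilateralDim ⌊(n : ℝ) ^ α⌋₊ n : ℝ) ≤ 4 * (n : ℝ) ^ max (1 - α) (2 * α) := by
  filter_upwards [eventually_ge_atTop 1] with n hn
  have hn' : (1 : ℝ) ≤ n := by exact_mod_cast hn
  have hn0 : (0 : ℝ) < n := by linarith
  have hp : (1 : ℝ) ≤ (n : ℝ) ^ α := Real.one_le_rpow hn' h1.le
  have hd : 0 < ⌊(n : ℝ) ^ α⌋₊ := Nat.floor_pos.2 hp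
  have hle : (⌊(n : ℝ) ^ α⌋₊ : ℝ) ≤ (n : ℝ) ^ α := Nat.floor_le (by positivity)
  have hlt : (n : ℝ) ^ α < ⌊(n : ℝ) ^ α⌋₊ + 1 := Nat.lt_floor_add_one _
  have hd' : (1 : ℝ) ≤ ⌊(n : ℝ) ^ α⌋₊ := by exact_mod_cast hd
  set d := ⌊(n : ℝ) ^ α⌋₊
  rcases equilateralDim_le_or hd n with h | h
  · have h' : (equilateralDim d n : ℝ) ≤ 4 * (d : ℝ) ^ 2 := by exact_mod_cast h
    have h2 : (n : ℝ) ^ (2 * α) ≤ (n : ℝ) ^ max (1 - α) (2 * α) :=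
      Real.rpow_le_rpow_of_exponent_le hn' (le_max_right _ _)
    have h3 : (n : ℝ) ^ (2 * α) = ((n : ℝ) ^ α) ^ 2 := by
      rw [mul_comm, Real.rpow_mul hn0.le, Real.rpow_two]
    nlinarith
  · have h' : (equilateralDim d n : ℝ) * d ≤ 2 * n := by exact_mod_cast h
    have h2 : (n : ℝ) ^ (1 - α) ≤ (n : ℝ) ^ max (1 - α) (2 * α) :=
      Real.rpow_le_rpow_of_exponent_le hn' (le_max_left _ _)
    have h3 : (n : ℝ) = (n : ℝ) ^ (1 - α) * (n : ℝ) ^ α := by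
      rw [← Real.rpow_add hn0, sub_add_cancel, Real.rpow_one]
    have h4 : 0 < (n : ℝ) ^ (1 - α) := by positivity
    refine le_trans ?_ (mul_le_mul_of_nonneg_left h2 (by norm_num))
    refine le_of_mul_le_mul_right ?_ (show (0 : ℝ) < d by linarith)
    calc _ ≤ 2 * (n : ℝ) := h'
      _ = 2 * (n : ℝ) ^ (1 - α) * (n : ℝ) ^ α := by rw [mul_assoc, ← h3]
      _ ≤ 2 * (n : ℝ) ^ (1 - α) * (2 * d) := by gcongr; linarith
      _ = _ := by ring

lemma exists_floor_rpow_eq {α : ℝ} (h1 : 0 < α) (h2 : α ≤ 1) {d : ℕ} :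
    ∃ n : ℕ, d ≤ n ∧ ⌊(n : ℝ) ^ α⌋₊ = d := by
  have hinv : 1 ≤ α⁻¹ := (one_le_inv₀ h1).2 h2
  have hd0 : (0 : ℝ) ≤ d := d.cast_nonneg
  have hle := Nat.le_ceil ((d : ℝ) ^ α⁻¹)
  have hlt := Nat.ceil_lt_add_one (show 0 ≤ (d : ℝ) ^ α⁻¹ by positivity)
  have hfl : ⌊(⌈(d : ℝ) ^ α⁻¹⌉₊ : ℝ) ^ α⌋₊ = d := by
    rw [Nat.floor_eq_iff (by positivity)]
    constructor
    · calc (d : ℝ) = ((d : ℝ) ^ α⁻¹) ^ α := (Real.rpow_inv_rpow hd0 h1.ne').symm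
        _ ≤ _ := by gcongr
    · have h3 : (d : ℝ) ^ α⁻¹ + 1 ≤ ((d : ℝ) + 1) ^ α⁻¹ := by
        simpa using Real.add_rpow_le_rpow_add hd0 zero_le_one hinv
      calc _ < (((d : ℝ) + 1) ^ α⁻¹) ^ α := by
            apply Real.rpow_lt_rpow (by positivity) (by linarith) h1
        _ = _ := Real.rpow_inv_rpow (by positivity) h1.ne'
  refine ⟨_, ?_, hfl⟩
  rcases Nat.eq_zero_or_pos d with rfl | hd
  · exact Nat.zero_le _
  · have : (d : ℝ) ≤ (d : ℝ) ^ α⁻¹ := by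
      simpa using Real.rpow_le_rpow_of_exponent_le (show (1 : ℝ) ≤ d by exact_mod_cast hd) hinv
    exact_mod_cast this.trans hle

lemma frequently_le_equilateralDim {α : ℝ} (h1 : 0 < α) (h2 : α ≤ 1 / 2) :
    ∃ᶠ n : ℕ in atTop,
      (n : ℝ) ^ max (1 - α) (2 * α) / 16 ≤ (equilateralDim ⌊(n : ℝ) ^ α⌋₊ n : ℝ) := by
  rw [frequently_atTop]
  intro N
  obtain ⟨q, hqN, hq⟩ := Nat.exists_infinite_primes N
  obtain ⟨n, hdn, hfl⟩ := exists_floor_rpow_eq h1 (by linarith) (d := 2 * q)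
  refine ⟨n, by omega, ?_⟩
  rw [hfl]
  have hq2 := hq.two_le
  have hn' : (1 : ℝ) ≤ n := by exact_mod_cast (by omega : 1 ≤ n)
  have hn0 : (0 : ℝ) < n := by linarith
  have hle : (2 * q : ℝ) ≤ (n : ℝ) ^ α := by
    have := Nat.floor_le (show 0 ≤ (n : ℝ) ^ α by positivity)
    rw [hfl] at this
    exact_mod_cast this
  have hlt : (n : ℝ) ^ α < 2 * q + 1 := by
    have := Nat.lt_floor_add_one ((n : ℝ) ^ α)
    rw [hfl] at this
    exact_mod_cast this
  have hq' : (2 : ℝ) ≤ q := by exact_mod_cast hq2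
  have hsq : (n : ℝ) ^ (2 * α) = ((n : ℝ) ^ α) ^ 2 := by
    rw [mul_comm, Real.rpow_mul hn0.le, Real.rpow_two]
  rcases max_choice (1 - α) (2 * α) with h | h <;> rw [h]
  · have h3 : (n : ℝ) = (n : ℝ) ^ (1 - α) * (n : ℝ) ^ α := by
      rw [← Real.rpow_add hn0, sub_add_cancel, Real.rpow_one]
    have h4 : 0 < (n : ℝ) ^ (1 - α) := by positivity
    have h5 := div_le_equilateralDim hq.pos (show q ≤ n by omega)
    have h6 : n ≤ 2 * q * equilateralDim (2 * q) n := by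
      have h7 := Nat.div_add_mod n q
      have h8 := Nat.mod_lt n hq.pos
      have h9 := equilateralDim_pos (2 * q) n
      nlinarith
    have h7 : (n : ℝ) ≤ 2 * q * equilateralDim (2 * q) n := by exact_mod_cast h6
    have h8 : (n : ℝ) ^ (1 - α) ≤ equilateralDim (2 * q) n := by
      refine le_of_mul_le_mul_left ?_ (show (0 : ℝ) < 2 * q by linarith)
      nlinarith
    linarith
  · have h3 : (n : ℝ) ^ (2 * α) ≤ n := by
      simpa using Real.rpow_le_rpow_of_exponent_le hn' (show 2 * α ≤ 1 by linarith)
    have h4 : ((q + 1) * q : ℝ) ≤ n := by nlinarith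
    have h5 : ((q ^ 2 : ℕ) : ℝ) ≤ equilateralDim (2 * q) n :=
      Nat.cast_le.2 (sq_le_equilateralDim hq (by exact_mod_cast h4))
    push_cast at h5
    rw [hsq]
    nlinarith

lemma tendsto_log_const_mul_rpow_div_log {C : ℝ} (hC : 0 < C) (β : ℝ) :
    Tendsto (fun n : ℕ => Real.log (C * (n : ℝ) ^ β) / Real.log n) atTop (nhds β) := by
  have hlog : Tendsto (fun n : ℕ => Real.log n) atTop atTop :=
    Real.tendsto_log_atTop.comp tendsto_natCast_atTop_atTop
  have h : Tendsto (fun n : ℕ => Real.log C / Real.log n + β) atTop (nhds (0 + β)) :=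
    (hlog.const_div_atTop _).add_const β
  rw [zero_add] at h
  refine h.congr' ?_
  filter_upwards [eventually_gt_atTop 1] with n hn
  have hn' : (1 : ℝ) < n := by exact_mod_cast hn
  have hn0 : (0 : ℝ) < n := by linarith
  have := Real.log_pos hn'
  rw [Real.log_mul hC.ne' (by positivity), Real.log_rpow hn0]
  field_simp

theorem limsup_equilateralDim_pow_small_alpha (α : ℝ) (h1 : 0 < α) (h2 : α ≤ 1 / 2) :
    limsup (fun n : ℕ =>
        Real.log (equilateralDim ⌊(n : ℝ) ^ α⌋₊ n) / Real.log n) atTop =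
      max (1 - α) (2 * α) := by
  set β := max (1 - α) (2 * α)
  have upper : ∀ᶠ n : ℕ in atTop, Real.log (equilateralDim ⌊(n : ℝ) ^ α⌋₊ n) / Real.log n ≤
      Real.log (4 * (n : ℝ) ^ β) / Real.log n := by
    filter_upwards [eventually_equilateralDim_le h1] with n hn
    have := equilateralDim_pos ⌊(n : ℝ) ^ α⌋₊ n
    gcongr
  have lower : ∃ᶠ n : ℕ in atTop, Real.log (1 / 16 * (n : ℝ) ^ β) / Real.log n ≤
      Real.log (equilateralDim ⌊(n : ℝ) ^ α⌋₊ n) / Real.log n := by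
    refine ((frequently_le_equilateralDim h1 h2).and_eventually (eventually_gt_atTop 0)).mono ?_
    rintro n ⟨hn, hn0⟩
    have hn0' : (0 : ℝ) < n := by exact_mod_cast hn0
    gcongr
    linarith
  have lim := tendsto_log_const_mul_rpow_div_log (show (0 : ℝ) < 4 by norm_num) β
  have lim' := tendsto_log_const_mul_rpow_div_log (show (0 : ℝ) < 1 / 16 by norm_num) β
  have cobdd : IsCoboundedUnder (· ≤ ·) atTop fun n : ℕ =>
      Real.log (equilateralDim ⌊(n : ℝ) ^ α⌋₊ n) / Real.log n :=
    isCoboundedUnder_le_of_le atTop (x := 0) fun n =>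
      div_nonneg (Real.log_natCast_nonneg _) (Real.log_natCast_nonneg n)
  apply le_antisymm
  · exact (limsup_le_limsup upper cobdd lim.isBoundedUnder_le).trans_eq lim.limsup_eq
  · refine le_of_forall_lt fun c hc => ?_
    obtain ⟨b, hcb, hb⟩ := exists_between hc
    refine hcb.trans_le (le_limsup_of_frequently_le ?_ (lim.isBoundedUnder_le.mono_le upper))
    exact (lower.and_eventually (lim'.eventually_const_lt hb)).mono
      fun n hn => hn.2.le.trans hn.1
end
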